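/- Let n be a natural number whose binary representation contains exactly three 1s. If the binary representation of the triangular number t_n = n(n+1)/2 also contains exactly three 1s, then n = 7 (and t_n = 28). -/

import Mathlib

/-- The n-th triangular number. -/
def triangular (n : ℕ) : ℕ := n * (n + 1) / 2

/-- A natural number is triangular if it is `triangular n` for some `n`. -/
def IsTriangular (m : ℕ) : Prop := ∃ n : ℕ, triangular n = m

/-- The number of 1s in the binary representation of `m` (binary digit sum). -/
def binOnes (m : ℕ) : ℕ := (Nat.digits 2 m).sum

/-- A number is very triangular if it is triangular and its binary digit sum is triangular. -/
def IsVeryTriangular (m : ℕ) : Prop := IsTriangular m ∧ IsTriangular (binOnes m)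

lemma binOnes_two_mul (m : ℕ) : binOnes (2 * m) = binOnes m := by
  rcases Nat.eq_zero_or_pos m with rfl | h
  · rfl
  · simp [binOnes, Nat.digits_def' (b := 2) (n := 2 * m) (by norm_num) (by omega)]

lemma binOnes_one_add_two_mul (m : ℕ) : binOnes (1 + 2 * m) = 1 + binOnes m := by
  simp [binOnes, Nat.add_mul_div_left]

lemma binOnes_two_pow_mul (k m : ℕ) : binOnes (2 ^ k * m) = binOnes m := by
  induction k with
  | zero => simp
  | succ k ih => rw [pow_succ', mul_assoc, binOnes_two_mul, ih]

lemma binOnes_zero : binOnes 0 = 0 := by simp [binOnes]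

lemma exists_eq_of_binOnes_eq_succ {s : ℕ} (m : ℕ) (h : binOnes m = s + 1) :
    ∃ k j, m = 2 ^ k * (1 + 2 * j) ∧ binOnes j = s := by
  have hm : m ≠ 0 := by
    rintro rfl
    simp [binOnes_zero] at h
  obtain ⟨k, r, ⟨j, rfl⟩, rfl⟩ := Nat.exists_eq_two_pow_mul_odd hm
  rw [add_comm (2 * j) 1] at h ⊢
  rw [binOnes_two_pow_mul, binOnes_one_add_two_mul] at h
  exact ⟨k, j, rfl, by omega⟩

lemma eq_zero_of_binOnes_eq_zero {m : ℕ} (h : binOnes m = 0) : m = 0 := by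
  by_contra hm
  obtain ⟨k, r, ⟨j, rfl⟩, rfl⟩ := Nat.exists_eq_two_pow_mul_odd hm
  rw [add_comm (2 * j) 1, binOnes_two_pow_mul, binOnes_one_add_two_mul] at h
  omega

lemma binOnes_pos {m : ℕ} (h : 0 < m) : 0 < binOnes m :=
  Nat.pos_of_ne_zero fun h0 => h.ne' (eq_zero_of_binOnes_eq_zero h0)

lemma exists_eq_two_pow_of_binOnes_eq_one {m : ℕ} (h : binOnes m = 1) : ∃ k, m = 2 ^ k := by
  obtain ⟨k, j, rfl, hj⟩ := exists_eq_of_binOnes_eq_succ (s := 0) m h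
  exact ⟨k, by simp [eq_zero_of_binOnes_eq_zero hj]⟩

lemma binOnes_ne_one_of_lt_of_lt {m k : ℕ} (h₁ : 2 ^ k < m) (h₂ : m < 2 ^ (k + 1)) :
    binOnes m ≠ 1 := by
  intro h
  obtain ⟨j, rfl⟩ := exists_eq_two_pow_of_binOnes_eq_one h
  have := (Nat.pow_lt_pow_iff_right (by norm_num)).1 h₁
  have := (Nat.pow_lt_pow_iff_right (by norm_num)).1 h₂
  omega

lemma exists_eq_of_binOnes_eq_three {n : ℕ} (h : binOnes n = 3) :
    ∃ k p q, n = 2 ^ k * (1 + 2 * (2 ^ p * (1 + 2 * 2 ^ q))) := by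
  obtain ⟨k, j, rfl, hj⟩ := exists_eq_of_binOnes_eq_succ n h
  obtain ⟨p, i, rfl, hi⟩ := exists_eq_of_binOnes_eq_succ j hj
  obtain ⟨q, rfl⟩ := exists_eq_two_pow_of_binOnes_eq_one hi
  exact ⟨k, p, q, rfl⟩

lemma binOnes_triangular_two_pow_mul (k m : ℕ) :
    binOnes (triangular (2 ^ k * m)) = binOnes (m * (1 + 2 ^ k * m)) := by
  have h : 2 * triangular (2 ^ k * m) = 2 ^ k * (m * (1 + 2 ^ k * m)) := by
    rw [triangular, Nat.mul_div_cancel' (Nat.even_mul_succ_self _).two_dvd]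
    ring
  rw [← binOnes_two_mul, h, binOnes_two_pow_mul]

/-- The case of an odd `n`. -/
lemma eq_zero_of_binOnes_mul_succ_eq_three {p q m : ℕ}
    (hm : m = 1 + 2 * (2 ^ p * (1 + 2 * 2 ^ q))) (h : binOnes (m * (1 + m)) = 3) :
    p = 0 ∧ q = 0 := by
  subst hm
  rcases p with _ | r
  · rcases q with _ | _ | r
    · simp
    · norm_num [binOnes] at h
    · rw [show (1 + 2 * (2 ^ 0 * (1 + 2 * 2 ^ (r + 1 + 1)))) *
          (1 + (1 + 2 * (2 ^ 0 * (1 + 2 * 2 ^ (r + 1 + 1))))) =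
          2 * (2 * (1 + 2 * (1 + 2 * (2 ^ r * (1 + 2 * (3 + 8 * 2 ^ r)))))) by ring] at h
      simp only [binOnes_two_mul, binOnes_one_add_two_mul, binOnes_two_pow_mul] at h
      have := binOnes_pos (m := 3 + 8 * 2 ^ r) (by positivity)
      omega
  · rw [show (1 + 2 * (2 ^ (r + 1) * (1 + 2 * 2 ^ q))) *
        (1 + (1 + 2 * (2 ^ (r + 1) * (1 + 2 * 2 ^ q)))) =
        2 * (1 + 2 * (2 ^ r * (1 + 2 * (1 + 3 * 2 ^ q + 2 * 2 ^ r * (1 + 2 * 2 ^ q) ^ 2))))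
        by ring] at h
    simp only [binOnes_two_mul, binOnes_one_add_two_mul, binOnes_two_pow_mul] at h
    rcases q with _ | s
    · rcases r with _ | _ | r
      · norm_num [binOnes] at h
      · norm_num [binOnes] at h
      · rw [show 1 + 3 * 2 ^ 0 + 2 * 2 ^ (r + 1 + 1) * (1 + 2 * 2 ^ 0) ^ 2 =
            2 * (2 * (1 + 2 * (9 * 2 ^ r))) by ring, binOnes_two_mul, binOnes_two_mul,
          binOnes_one_add_two_mul] at h
        have := binOnes_pos (m := 9 * 2 ^ r) (by positivity)
        omega
    · rw [show 1 + 3 * 2 ^ (s + 1) + 2 * 2 ^ r * (1 + 2 * 2 ^ (s + 1)) ^ 2 =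
          1 + 2 * (3 * 2 ^ s + 2 ^ r * (1 + 2 * 2 ^ (s + 1)) ^ 2) by ring,
        binOnes_one_add_two_mul] at h
      have := binOnes_pos (m := 3 * 2 ^ s + 2 ^ r * (1 + 2 * 2 ^ (s + 1)) ^ 2) (by positivity)
      omega

lemma binOnes_sq_add_ne_two (p q : ℕ) :
    binOnes (1 + 2 * (2 ^ p * (1 + 2 * 2 ^ q) + (2 ^ p * (1 + 2 * 2 ^ q)) ^ 2) + 2 ^ q) ≠ 2 := by
  intro h
  rcases q with _ | s
  · rcases p with _ | r
    · norm_num [binOnes] at h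
    · rw [show 1 + 2 * (2 ^ (r + 1) * (1 + 2 * 2 ^ 0) + (2 ^ (r + 1) * (1 + 2 * 2 ^ 0)) ^ 2) +
          2 ^ 0 = 2 * (1 + 2 * (2 ^ r * (1 + 2 * (1 + 9 * 2 ^ r)))) by ring] at h
      simp only [binOnes_two_mul, binOnes_one_add_two_mul, binOnes_two_pow_mul] at h
      have := binOnes_pos (m := 1 + 9 * 2 ^ r) (by positivity)
      omega
  · rw [show 1 + 2 * (2 ^ p * (1 + 2 * 2 ^ (s + 1)) + (2 ^ p * (1 + 2 * 2 ^ (s + 1))) ^ 2) +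
        2 ^ (s + 1) = 1 + 2 * (2 ^ p * (1 + 4 * 2 ^ s) + (2 ^ p * (1 + 4 * 2 ^ s)) ^ 2 + 2 ^ s)
        by ring, binOnes_one_add_two_mul] at h
    refine binOnes_ne_one_of_lt_of_lt (k := 2 * p + 2 * s + 4) ?_ ?_
      (Nat.add_left_cancel (n := 1) h)
    · rw [show 2 ^ (2 * p + 2 * s + 4) = 16 * (2 ^ p) ^ 2 * (2 ^ s) ^ 2 by ring]
      have hP : 0 < 2 ^ p := by positivity
      nlinarith [Nat.zero_le ((2 ^ p) ^ 2 * 2 ^ s), Nat.zero_le (2 ^ p * 2 ^ s)]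
    · rw [show 2 ^ (2 * p + 2 * s + 4 + 1) = 32 * ((2 ^ p) ^ 2 * (2 ^ s) ^ 2) by ring]
      have hP : 1 ≤ 2 ^ p := Nat.one_le_two_pow
      have hS : 1 ≤ 2 ^ s := Nat.one_le_two_pow
      generalize 2 ^ p = P at *
      generalize 2 ^ s = S at *
      have hPP : P ≤ P ^ 2 := by nlinarith
      have hSS : S ≤ S ^ 2 := by nlinarith
      have h₁ : P * 1 ≤ P ^ 2 * S ^ 2 := Nat.mul_le_mul hPP (hS.trans hSS)
      have h₂ : P * S ≤ P ^ 2 * S ^ 2 := Nat.mul_le_mul hPP hSS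
      have h₃ : P ^ 2 * 1 ≤ P ^ 2 * S ^ 2 := Nat.mul_le_mul le_rfl (hS.trans hSS)
      have h₄ : P ^ 2 * S ≤ P ^ 2 * S ^ 2 := Nat.mul_le_mul le_rfl hSS
      have h₅ : 1 * S ≤ P ^ 2 * S ^ 2 := Nat.mul_le_mul (hP.trans hPP) hSS
      have h₆ : 1 * 1 ≤ P ^ 2 * S ^ 2 := Nat.mul_le_mul (hP.trans hPP) (hS.trans hSS)
      nlinarith

lemma binOnes_two_pow_add_two_pow_mul_sq_ne_one (q r y : ℕ) (hy : 0 < y) :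
    binOnes (2 ^ q + 2 ^ r * (1 + 2 * y) ^ 2) ≠ 1 := by
  intro h
  rcases lt_trichotomy q r with hqr | rfl | hqr
  · obtain ⟨s, rfl⟩ := Nat.exists_eq_add_of_lt hqr
    rw [show 2 ^ q + 2 ^ (q + s + 1) * (1 + 2 * y) ^ 2 =
        2 ^ q * (1 + 2 * (2 ^ s * (1 + 2 * y) ^ 2)) by ring, binOnes_two_pow_mul,
      binOnes_one_add_two_mul] at h
    have := binOnes_pos (m := 2 ^ s * (1 + 2 * y) ^ 2) (by positivity)
    omega
  · rw [show 2 ^ q + 2 ^ q * (1 + 2 * y) ^ 2 = 2 ^ q * (2 * (1 + 2 * (y + y ^ 2))) by ring,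
      binOnes_two_pow_mul, binOnes_two_mul, binOnes_one_add_two_mul] at h
    have := binOnes_pos (m := y + y ^ 2) (by positivity)
    omega
  · obtain ⟨s, rfl⟩ := Nat.exists_eq_add_of_lt hqr
    rw [show 2 ^ (r + s + 1) + 2 ^ r * (1 + 2 * y) ^ 2 =
        2 ^ r * (1 + 2 * (2 ^ s + 2 * (y + y ^ 2))) by ring, binOnes_two_pow_mul,
      binOnes_one_add_two_mul] at h
    have := binOnes_pos (m := 2 ^ s + 2 * (y + y ^ 2)) (by positivity)
    omega

/-- The case of an even `n`. -/
lemma binOnes_mul_one_add_two_pow_mul_ne_three {k p q m : ℕ}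
    (hm : m = 1 + 2 * (2 ^ p * (1 + 2 * 2 ^ q))) :
    binOnes (m * (1 + 2 ^ (k + 1) * m)) ≠ 3 := by
  subst hm
  intro h
  rcases lt_trichotomy k p with hkp | rfl | hkp
  · obtain ⟨r, rfl⟩ := Nat.exists_eq_add_of_lt hkp
    rw [show (1 + 2 * (2 ^ (k + r + 1) * (1 + 2 * 2 ^ q))) *
        (1 + 2 ^ (k + 1) * (1 + 2 * (2 ^ (k + r + 1) * (1 + 2 * 2 ^ q)))) =
        1 + 2 * (2 ^ k * (1 + 2 * (2 ^ r * (1 + 2 * (2 ^ q + 2 ^ k * (2 * (1 + 2 * 2 ^ q) +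
          4 * 2 ^ k * 2 ^ r * (1 + 2 * 2 ^ q) ^ 2)))))) by ring] at h
    simp only [binOnes_one_add_two_mul, binOnes_two_pow_mul] at h
    have := binOnes_pos (m := 2 ^ q + 2 ^ k * (2 * (1 + 2 * 2 ^ q) +
          4 * 2 ^ k * 2 ^ r * (1 + 2 * 2 ^ q) ^ 2)) (by positivity)
    omega
  · rw [show (1 + 2 * (2 ^ k * (1 + 2 * 2 ^ q))) *
        (1 + 2 ^ (k + 1) * (1 + 2 * (2 ^ k * (1 + 2 * 2 ^ q)))) =
        1 + 2 * (2 ^ k * (2 * (1 + 2 * (2 ^ k * (1 + 2 * 2 ^ q) +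
          (2 ^ k * (1 + 2 * 2 ^ q)) ^ 2) + 2 ^ q))) by ring, binOnes_one_add_two_mul,
      binOnes_two_pow_mul, binOnes_two_mul] at h
    exact binOnes_sq_add_ne_two k q (by omega)
  · obtain ⟨r, rfl⟩ := Nat.exists_eq_add_of_lt hkp
    rw [show (1 + 2 * (2 ^ p * (1 + 2 * 2 ^ q))) *
        (1 + 2 ^ (p + r + 1 + 1) * (1 + 2 * (2 ^ p * (1 + 2 * 2 ^ q)))) =
        1 + 2 * (2 ^ p * (1 + 2 * (2 ^ q + 2 ^ r * (1 + 2 * (2 ^ p * (1 + 2 * 2 ^ q))) ^ 2)))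
        by ring, binOnes_one_add_two_mul, binOnes_two_pow_mul, binOnes_one_add_two_mul] at h
    exact binOnes_two_pow_add_two_pow_mul_sq_ne_one q r (2 ^ p * (1 + 2 * 2 ^ q))
      (by positivity) (by omega)

theorem stmt6 (n : ℕ) (hn : binOnes n = 3) (ht : binOnes (triangular n) = 3) :
    n = 7 ∧ triangular n = 28 := by
  obtain ⟨k, p, q, rfl⟩ := exists_eq_of_binOnes_eq_three hn
  rw [binOnes_triangular_two_pow_mul] at ht
  rcases k with _ | k
  · rw [pow_zero, one_mul] at ht
    obtain ⟨rfl, rfl⟩ := eq_zero_of_binOnes_mul_succ_eq_three rfl ht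
    norm_num [triangular]
  · exact absurd ht (binOnes_mul_one_add_two_pow_mul_ne_three rfl)
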